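/- arXiv:math/0205087 — 2 statements merged into one kernel-verified Lean document; each statement's English description precedes it below -/
import Mathlib

section
/- Assume u ∉ k (u is not a constant polynomial). Then: (i) for every L ∈ (ℕ →₀ k[t]) there exists P ∈ k[t] such that L − single_0(P) lies in the image of δ10; and (ii) for P ∈ k[t], single_0(P) lies in the image of δ10 if and only if P belongs to the k-linear span of {T_λ(u^n) : n ≥ 1}. (Lemma 2.2.4: H_0(W_{*0}(E)) = coker δ_{10} is isomorphic to k[t] modulo Σ_{n≥1} k·T_λ(u^n).) -/
open Polynomial

/-- `T μ P = P(t+μ) − P(t)`, the difference operator of Section 2.2 of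
Guccione–Guccione, "Hochschild homology of iterated skew polynomial rings". -/
noncomputable def Tdiff {k : Type*} [Field k] (μ : k) (P : k[X]) : k[X] :=
  P.comp (X + C μ) - P



/-- Complete homogeneous polynomial of degree `d` in the first `n` terms of `x`. -/
noncomputable def hsym {R : Type*} [CommRing R] (x : ℕ → R) : ℕ → ℕ → R
  | _, 0 => 1
  | 0, _ + 1 => 0
  | n + 1, d + 1 => hsym x n (d + 1) + x n * hsym x (n + 1) d

lemma hsym_deg_zero {R : Type*} [CommRing R] (x : ℕ → R) (n : ℕ) : hsym x n 0 = 1 := by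
  cases n <;> simp [hsym]

lemma hsym_no_var {R : Type*} [CommRing R] (x : ℕ → R) (d : ℕ) : hsym x 0 (d + 1) = 0 := by
  simp [hsym]

lemma hsym_rec {R : Type*} [CommRing R] (x : ℕ → R) (n d : ℕ) :
    hsym x (n + 1) (d + 1) = hsym x n (d + 1) + x n * hsym x (n + 1) d := by
  simp [hsym]

lemma hsym_rec' {R : Type*} [CommRing R] (x : ℕ → R) (n d : ℕ) :
    hsym x (n + 1) (d + 1) =
      hsym (fun i => x (i + 1)) n (d + 1) + x 0 * hsym x (n + 1) d := by
  induction n generalizing d with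
  | zero => rw [hsym_rec, hsym_no_var, hsym_no_var]
  | succ n ih =>
    induction d with
    | zero =>
      rw [hsym_rec, ih, hsym_rec (fun i => x (i + 1))]
      simp only [hsym_deg_zero]
      ring
    | succ d ihd =>
      rw [hsym_rec, ih, hsym_rec (fun i => x (i + 1))]
      have h2 := hsym_rec x (n + 1) d
      linear_combination x (n + 1) * ihd - x 0 * h2

lemma hsym_diff {R : Type*} [CommRing R] (x : ℕ → R) (n d : ℕ) :
    hsym (fun i => x (i + 1)) n (d + 1) - hsym x n (d + 1) =
      (x n - x 0) * hsym x (n + 1) d := by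
  linear_combination hsym_rec x n d - hsym_rec' x n d

lemma hsym_one {R : Type*} [CommRing R] (x : ℕ → R) (d : ℕ) : hsym x 1 d = x 0 ^ d := by
  induction d with
  | zero => simp [hsym_deg_zero]
  | succ d ih => rw [hsym_rec, hsym_no_var, ih]; ring

lemma hsym_map {R S : Type*} [CommRing R] [CommRing S] (f : R →+* S) (x : ℕ → R) (n d : ℕ) :
    f (hsym x n d) = hsym (fun i => f (x i)) n d := by
  induction n generalizing d with
  | zero => cases d <;> simp [hsym]
  | succ n ih =>
    induction d with
    | zero => simp [hsym_deg_zero]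
    | succ d ihd => rw [hsym_rec, hsym_rec, map_add, map_mul, ih, ihd]

section
variable {k : Type*} [Field k]

lemma Tdiff_add (μ : k) (P Q : k[X]) : Tdiff μ (P + Q) = Tdiff μ P + Tdiff μ Q := by
  simp only [Tdiff, add_comp]; ring

lemma Tdiff_zero (μ : k) : Tdiff μ (0 : k[X]) = 0 := by simp [Tdiff]

lemma Tdiff_one (μ : k) : Tdiff μ (1 : k[X]) = 0 := by simp [Tdiff]

/-- translates of `u` -/
noncomputable def utr (lam : k) (u : k[X]) (i : ℕ) : k[X] := u.comp (X + C ((i : k) * lam))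

lemma utr_comp (lam : k) (u : k[X]) (i : ℕ) :
    (utr lam u i).comp (X + C lam) = utr lam u (i + 1) := by
  simp only [utr, comp_assoc]
  congr 1
  simp
  ring

lemma Tdiff_hsym (lam : k) (u : k[X]) (n d : ℕ) :
    Tdiff lam (hsym (utr lam u) n (d + 1)) =
      Tdiff ((n : k) * lam) u * hsym (utr lam u) (n + 1) d := by
  have h1 : (hsym (utr lam u) n (d + 1)).comp (X + C lam) =
      hsym (fun i => utr lam u (i + 1)) n (d + 1) := by
    have := hsym_map (compRingHom (X + C lam)) (utr lam u) n (d + 1)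
    simpa only [coe_compRingHom_apply, utr_comp] using this
  rw [Tdiff, h1, hsym_diff]
  simp [Tdiff, utr]

lemma Tdiff_ker [CharZero k] (lam : k) (hlam : lam ≠ 0) (P : k[X]) (h : Tdiff lam P = 0) :
    ∃ c, P = C c := by
  refine ⟨P.eval 0, ?_⟩
  have hs : ∀ n : ℕ, P.eval ((n : k) * lam) = P.eval 0 := by
    intro n
    induction n with
    | zero => simp
    | succ n ih =>
      have := congrArg (eval ((n : k) * lam)) h
      simp only [Tdiff, eval_sub, eval_comp, eval_add, eval_X, eval_C, eval_zero] at this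
      rw [← ih, ← sub_eq_zero, ← this]
      congr 2
      push_cast
      ring
  apply eq_of_infinite_eval_eq
  refine Set.Infinite.mono (s := Set.range fun n : ℕ => (n : k) * lam) ?_ ?_
  · rintro _ ⟨n, rfl⟩
    simpa using hs n
  · apply Set.infinite_range_of_injective
    intro a b hab
    exact_mod_cast mul_right_cancel₀ hlam hab

lemma Tdiff_surj [CharZero k] (lam : k) (hlam : lam ≠ 0) (R : k[X]) :
    ∃ Q, Tdiff lam Q = R := by
  suffices H : ∀ n : ℕ, ∀ R : k[X], R.degree < n → ∃ Q, Tdiff lam Q = R by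
    exact H (R.natDegree + 1) R (lt_of_le_of_lt degree_le_natDegree (by exact_mod_cast Nat.lt_succ_self _))
  intro n
  induction n with
  | zero =>
    intro R hR
    refine ⟨0, ?_⟩
    have : R = 0 := by
      ext m
      simpa using (degree_lt_iff_coeff_zero R 0).1 hR m (Nat.zero_le _)
    rw [this, Tdiff_zero]
  | succ n ih =>
    intro R hR
    have hn : ((n : k) + 1) ≠ 0 := by exact_mod_cast Nat.succ_ne_zero n
    set c := R.coeff n / (((n : k) + 1) * lam) with hc
    have hcoeff : ∀ m, (Tdiff lam (C c * X ^ (n + 1))).coeff m =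
        c * (lam ^ (n + 1 - m) * ((n + 1).choose m : k)) - c * (if m = n + 1 then 1 else 0) := by
      intro m
      simp only [Tdiff, mul_comp, C_comp, pow_comp, X_comp, coeff_sub, coeff_C_mul,
        coeff_X_add_C_pow, coeff_X_pow]
    obtain ⟨Q, hQ⟩ := ih (R - Tdiff lam (C c * X ^ (n + 1))) (by
      rw [degree_lt_iff_coeff_zero] at hR ⊢
      intro m hm
      rw [coeff_sub, hcoeff]
      rcases hm.eq_or_lt with rfl | hm
      · simp only [Nat.add_sub_cancel_left, pow_one, Nat.choose_succ_self_right, hc]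
        simp
        field_simp
        ring
      · rw [hR m hm]
        rcases (Nat.succ_le_of_lt hm).eq_or_lt with rfl | hm'
        · simp
        · rw [Nat.choose_eq_zero_of_lt hm', if_neg (by omega)]
          simp)
    exact ⟨Q + C c * X ^ (n + 1), by rw [Tdiff_add, hQ]; ring⟩

/-- The element of the chain module attached to `u ^ m`. -/
noncomputable def chainF (lam : k) (u : k[X]) (m : ℕ) : ℕ →₀ k[X] :=
  ∑ j ∈ Finset.range m,
    Finsupp.single j ((-1) ^ j * hsym (utr lam u) (j + 2) (m - 1 - j))

lemma Tdiff_sign (μ : k) (j : ℕ) (P : k[X]) :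
    Tdiff μ ((-1) ^ j * P) = (-1) ^ j * Tdiff μ P := by
  simp [Tdiff]; ring

lemma D_chainF (lam : k) (u : k[X])
    (D : (ℕ →₀ k[X]) →ₗ[k] (ℕ →₀ k[X]))
    (hD : ∀ (j : ℕ) (Q : k[X]),
      D (Finsupp.single j Q) =
        -Finsupp.single (j + 1) (Tdiff lam Q) -
          Finsupp.single j (Q * Tdiff (((j : k) + 1) * lam) u)) (m : ℕ) :
    D (chainF lam u m) = -Finsupp.single 0 (Tdiff lam (u ^ m)) := by
  let G : ℕ → (ℕ →₀ k[X]) := fun j =>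
    Finsupp.single j ((-1) ^ j * Tdiff lam (hsym (utr lam u) (j + 1) (m - j)))
  have key : D (chainF lam u m) = ∑ j ∈ Finset.range m, (G (j + 1) - G j) := by
    rw [chainF, map_sum]
    refine Finset.sum_congr rfl fun j hj => ?_
    have hj := Finset.mem_range.1 hj
    obtain ⟨d, rfl⟩ : ∃ d, m = j + 1 + d := ⟨m - (j + 1), by omega⟩
    have e1 : j + 1 + d - 1 - j = d := by omega
    have e2 : j + 1 + d - j = d + 1 := by omega
    have e3 : j + 1 + d - (j + 1) = d := by omega
    simp only [G, hD, e1, e2, e3, Tdiff_sign]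
    rw [Tdiff_hsym lam u (j + 1) d]
    push_cast
    rw [← Finsupp.single_neg]
    congr 2 <;> ring
  rw [key, Finset.sum_range_sub]
  simp only [G, Nat.sub_self, hsym_deg_zero, Tdiff_one, mul_zero, Finsupp.single_zero, zero_sub,
    pow_zero, one_mul, Nat.sub_zero, zero_add, hsym_one]
  simp [utr]

lemma chainF_apply (lam : k) (u : k[X]) (m i : ℕ) :
    chainF lam u m i =
      if i < m then (-1) ^ i * hsym (utr lam u) (i + 2) (m - 1 - i) else 0 := by
  classical
  rw [chainF, Finsupp.finsetSum_apply]
  simp [Finsupp.single_apply]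

lemma D_apply_succ (lam : k) (u : k[X])
    (D : (ℕ →₀ k[X]) →ₗ[k] (ℕ →₀ k[X]))
    (hD : ∀ (j : ℕ) (Q : k[X]),
      D (Finsupp.single j Q) =
        -Finsupp.single (j + 1) (Tdiff lam Q) -
          Finsupp.single j (Q * Tdiff (((j : k) + 1) * lam) u)) (F : ℕ →₀ k[X]) (n : ℕ) :
    D F (n + 1) = -Tdiff lam (F n) - F (n + 1) * Tdiff (((n : k) + 1 + 1) * lam) u := by
  classical
  induction F using Finsupp.induction_linear with
  | zero => simp [Tdiff_zero]
  | add f g hf hg =>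
    rw [map_add D f g, Finsupp.add_apply, hf, hg, Finsupp.add_apply, Finsupp.add_apply, Tdiff_add]
    ring
  | single j Q =>
    rw [hD]
    simp only [Finsupp.sub_apply, Finsupp.neg_apply, Finsupp.single_apply, Nat.add_right_cancel_iff]
    by_cases h1 : j = n
    · subst h1
      simp
    · by_cases h2 : j = n + 1
      · subst h2
        simp [Tdiff_zero]
      · simp [h1, h2, Tdiff_zero]

end

/-- Lemma 2.2.4 of Guccione–Guccione (computation of `H₀(W_{*0}(E))`): if
`u ∉ k`, then (i) every element of `⊕_{i≥0} k[t]·x^i y^i` is congruent,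
modulo the image of `δ₁₀`, to one concentrated in degree `x⁰y⁰`; and (ii)
`P·x⁰y⁰` lies in the image of `δ₁₀` iff `P ∈ Σ_{n≥1} k·T_λ(u^n)`. -/
theorem stmt10 {k : Type*} [Field k] [CharZero k] (lam : k) (hlam : lam ≠ 0)
    (u : k[X]) (hu : ∀ c : k, u ≠ C c)
    (D : (ℕ →₀ k[X]) →ₗ[k] (ℕ →₀ k[X]))
    (hD : ∀ (j : ℕ) (Q : k[X]),
      D (Finsupp.single j Q) =
        -Finsupp.single (j + 1) (Tdiff lam Q) -
          Finsupp.single j (Q * Tdiff (((j : k) + 1) * lam) u)) :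
    (∀ L : ℕ →₀ k[X], ∃ P : k[X],
        L - Finsupp.single 0 P ∈ LinearMap.range D) ∧
      ∀ P : k[X], Finsupp.single 0 P ∈ LinearMap.range D ↔
        P ∈ Submodule.span k {Q : k[X] | ∃ n : ℕ, 1 ≤ n ∧ Q = Tdiff lam (u ^ n)} := by
  constructor
  · have hs : ∀ (j : ℕ) (R : k[X]), ∃ P : k[X],
        Finsupp.single j R - Finsupp.single 0 P ∈ LinearMap.range D := by
      intro j
      induction j with
      | zero => exact fun R => ⟨R, by simp⟩
      | succ j ih =>
        intro R
        obtain ⟨Q, hQ⟩ := Tdiff_surj lam hlam R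
        obtain ⟨P, hP⟩ := ih (-(Q * Tdiff (((j : k) + 1) * lam) u))
        refine ⟨P, ?_⟩
        have h2 := Submodule.sub_mem _ hP (LinearMap.mem_range_self D (Finsupp.single j Q))
        rw [hD, hQ, Finsupp.single_neg] at h2
        convert h2 using 1
        abel
    intro L
    induction L using Finsupp.induction_linear with
    | zero => exact ⟨0, by simp⟩
    | add f g hf hg =>
      obtain ⟨P, hP⟩ := hf
      obtain ⟨Q, hQ⟩ := hg
      refine ⟨P + Q, ?_⟩
      have h := Submodule.add_mem _ hP hQ
      rw [Finsupp.single_add]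
      convert h using 1
      abel
    | single j R => exact hs j R
  · intro P
    constructor
    · rintro ⟨F, hF⟩
      have H : ∀ n : ℕ, ∀ (F : ℕ →₀ k[X]) (P : k[X]), (∀ i, n ≤ i → F i = 0) →
          D F = Finsupp.single 0 P →
          P ∈ Submodule.span k {Q : k[X] | ∃ n : ℕ, 1 ≤ n ∧ Q = Tdiff lam (u ^ n)} := by
        intro n
        induction n with
        | zero =>
          intro F P h0 hF
          have : F = 0 := by
            ext1 i
            exact h0 i (Nat.zero_le _)
          rw [this, map_zero] at hF
          rw [Finsupp.single_eq_zero.1 hF.symm]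
          exact Submodule.zero_mem _
        | succ n ih =>
          intro F P h0 hF
          have h1 := D_apply_succ lam u D hD F n
          rw [hF, h0 (n + 1) le_rfl] at h1
          have h2 : Tdiff lam (F n) = 0 := by simpa using h1
          obtain ⟨c, hc⟩ := Tdiff_ker lam hlam _ h2
          have h3 := ih (F - (c * (-1) ^ n) • chainF lam u (n + 1))
            (P + (c * (-1) ^ n) • Tdiff lam (u ^ (n + 1))) (by
              intro i hi
              rw [Finsupp.sub_apply, Finsupp.smul_apply, chainF_apply]
              rcases hi.eq_or_lt with rfl | hi
              · rw [hc, if_pos (Nat.lt_succ_self _)]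
                have : n + 1 - 1 - n = 0 := by omega
                rw [this, hsym_deg_zero, smul_eq_C_mul, C_mul, C_pow, C_neg, C_1, mul_one,
                  mul_assoc, ← mul_pow]
                simp
              · rw [h0 i hi, if_neg (by omega)]
                simp) (by
              rw [map_sub, map_smul, D_chainF lam u D hD, hF, Finsupp.single_add,
                ← Finsupp.smul_single, smul_neg, sub_neg_eq_add])
          have h4 : Tdiff lam (u ^ (n + 1)) ∈
              Submodule.span k {Q : k[X] | ∃ n : ℕ, 1 ≤ n ∧ Q = Tdiff lam (u ^ n)} :=
            Submodule.subset_span ⟨n + 1, by omega, rfl⟩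
          exact (Submodule.add_mem_iff_left _ (Submodule.smul_mem _ _ h4)).1 h3
      refine H (F.support.sup id + 1) F P ?_ hF
      intro i hi
      by_contra hne
      have := Finset.le_sup (f := id) (Finsupp.mem_support_iff.2 hne)
      simp only [id] at this
      change i ≤ F.support.sup id at this
      omega
    · intro hP
      have hle : Submodule.span k {Q : k[X] | ∃ n : ℕ, 1 ≤ n ∧ Q = Tdiff lam (u ^ n)} ≤
          (LinearMap.range D).comap (Finsupp.lsingle 0) := by
        rw [Submodule.span_le]
        rintro _ ⟨n, -, rfl⟩
        refine ⟨-chainF lam u n, ?_⟩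
        rw [map_neg, D_chainF lam u D hD, neg_neg]
        rfl
      exact hle hP
end

section
/- For every integer n ≥ 0, δ11(𝔙_n) = 0, i.e. the element 𝔙_n = x^n y^n e₁e₂ + Σ_{j=0}^{n−1} 𝔘_{j−1}^{n−1}(t+λ) x^j y^j e₁e₂ belongs to the kernel of the boundary map δ_{11}. (Lemma 2.2.5.) -/
open Polynomial

open scoped Classical in
/-- `𝔘_j^n = (−1)^{n−j} Σ_{0 ≤ i₁ ≤ ⋯ ≤ i_{n−j} ≤ j+1} u(t+i₁λ)⋯u(t+i_{n−j}λ)`,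
the sum running over weakly increasing sequences of `n−j` integers between `0`
and `j+1` (so `𝔘_n^n = 1`). -/
noncomputable def Ufrak {k : Type*} [Field k] (u : k[X]) (lam : k) (n : ℕ) (j : ℤ) : k[X] :=
  (-1) ^ (((n : ℤ) - j).toNat) *
    ∑ f ∈ Finset.univ.filter
        (fun f : Fin (((n : ℤ) - j).toNat) → Fin ((j + 2).toNat) => Monotone f),
      ∏ l, u.comp (X + C (((f l : ℕ) : k) * lam))

/-- `𝔙_n = x^n y^n e₁e₂ + Σ_{j=0}^{n−1} 𝔘_{j−1}^{n−1}(t+λ) x^j y^j e₁e₂`,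
modelled in `ℕ →₀ k[t]`. -/
noncomputable def Vfrak {k : Type*} [Field k] (u : k[X]) (lam : k) (n : ℕ) :
    ℕ →₀ k[X] :=
  Finsupp.single n 1 +
    ∑ j ∈ Finset.range n,
      Finsupp.single j ((Ufrak u lam (n - 1) ((j : ℤ) - 1)).comp (X + C lam))

open scoped Classical in
/-- complete homogeneous sum over monotone maps -/
noncomputable def HH {R : Type*} [CommRing R] (a : ℕ → R) (m p : ℕ) : R :=
  ∑ f ∈ Finset.univ.filter (fun f : Fin m → Fin p => Monotone f), ∏ l, a (f l : ℕ)

theorem HH_first {R : Type*} [CommRing R] (a : ℕ → R) (m p : ℕ) :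
    HH a (m+1) (p+1) = a 0 * HH a m (p+1) + HH (fun i => a (i+1)) (m+1) p := by
  classical
  unfold HH
  rw [← Finset.sum_filter_add_sum_filter_not _ (fun f : Fin (m+1) → Fin (p+1) => f 0 = 0)]
  congr 1
  · rw [Finset.mul_sum]
    symm
    refine Finset.sum_nbij' (fun f => (Fin.cons 0 f : Fin (m+1) → Fin (p+1)))
      (fun f => Fin.tail f) ?_ ?_ ?_ ?_ ?_
    · intro f hf
      simp only [Finset.mem_filter, Finset.mem_univ, true_and] at hf ⊢
      refine ⟨?_, by simp⟩
      intro i j hij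
      induction i using Fin.cases with
      | zero => simp
      | succ i =>
        induction j using Fin.cases with
        | zero => simp at hij
        | succ j => simpa using hf (by simpa using hij)
    · intro f hf
      simp only [Finset.mem_filter, Finset.mem_univ, true_and] at hf ⊢
      intro i j hij
      exact hf.1 (by simpa using hij)
    · intro f hf
      simp
    · intro f hf
      simp only [Finset.mem_filter, Finset.mem_univ, true_and] at hf
      rw [← hf.2, Fin.cons_self_tail]
    · intro f hf
      simp [Fin.prod_univ_succ]
  · symm
    refine Finset.sum_nbij (fun f l => (f l).succ) ?_ ?_ ?_ ?_
    · intro f hf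
      simp only [Finset.mem_filter, Finset.mem_univ, true_and] at hf ⊢
      exact ⟨fun i j hij => by simpa using hf hij, Fin.succ_ne_zero _⟩
    · intro f _ g _ h
      funext l
      exact Fin.succ_injective _ (congrFun h l)
    · intro f hf
      simp only [Finset.coe_filter, Finset.mem_filter, Finset.mem_univ, true_and,
        Set.mem_ofPred_eq] at hf
      have hne : ∀ l, f l ≠ 0 := fun l h => hf.2 (by
        have := hf.1 (Fin.zero_le l)
        rw [h] at this
        exact Fin.le_zero_iff.mp this)
      refine ⟨fun l => (f l).pred (hne l), ?_, ?_⟩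
      · simp only [Finset.coe_filter, Finset.mem_univ, true_and, Set.mem_ofPred_eq]
        intro i j hij
        exact Fin.pred_le_pred_iff.mpr (hf.1 hij)
      · funext l
        simp
    · intro f _
      simp

theorem HH_last {R : Type*} [CommRing R] (a : ℕ → R) (m p : ℕ) :
    HH a (m+1) (p+1) = a p * HH a m (p+1) + HH a (m+1) p := by
  classical
  unfold HH
  rw [← Finset.sum_filter_add_sum_filter_not _
    (fun f : Fin (m+1) → Fin (p+1) => f (Fin.last m) = Fin.last p)]
  congr 1
  · rw [Finset.mul_sum]
    symm
    refine Finset.sum_nbij'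
      (fun f => (Fin.snoc (α := fun _ => Fin (p+1)) f (Fin.last p) : Fin (m+1) → Fin (p+1)))
      (fun f => Fin.init f) ?_ ?_ ?_ ?_ ?_
    · intro f hf
      simp only [Finset.mem_filter, Finset.mem_univ, true_and] at hf ⊢
      refine ⟨?_, by simp⟩
      intro i j hij
      induction j using Fin.lastCases with
      | last => simpa using Fin.le_last _
      | cast j =>
        induction i using Fin.lastCases with
        | last => exact absurd hij (not_le.mpr (Fin.castSucc_lt_last j))
        | cast i => simpa using hf (by simpa using hij)
    · intro f hf
      simp only [Finset.mem_filter, Finset.mem_univ, true_and] at hf ⊢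
      intro i j hij
      exact hf.1 (by simpa using hij)
    · intro f hf
      simp
    · intro f hf
      simp only [Finset.mem_filter, Finset.mem_univ, true_and] at hf
      rw [← hf.2, Fin.snoc_init_self]
    · intro f hf
      simp [Fin.prod_univ_castSucc, mul_comm]
  · symm
    refine Finset.sum_nbij (fun f l => (f l).castSucc) ?_ ?_ ?_ ?_
    · intro f hf
      simp only [Finset.mem_filter, Finset.mem_univ, true_and] at hf ⊢
      exact ⟨fun i j hij => by simpa using hf hij, Fin.castSucc_ne_last _⟩
    · intro f _ g _ h
      funext l
      exact Fin.castSucc_injective _ (congrFun h l)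
    · intro f hf
      simp only [Finset.coe_filter, Finset.mem_filter, Finset.mem_univ, true_and,
        Set.mem_ofPred_eq] at hf
      have hne : ∀ l, f l ≠ Fin.last p := fun l h => hf.2 (by
        have := hf.1 (Fin.le_last l)
        rw [h] at this
        exact Fin.last_le_iff.mp this)
      refine ⟨fun l => (f l).castPred (hne l), ?_, ?_⟩
      · simp only [Finset.coe_filter, Finset.mem_univ, true_and, Set.mem_ofPred_eq]
        intro i j hij
        exact Fin.castPred_le_castPred_iff.mpr (hf.1 hij)
      · funext l
        simp
    · intro f _
      simp

theorem HH_key {R : Type*} [CommRing R] (a : ℕ → R) (m p : ℕ) :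
    HH (fun i => a (i+1)) (m+1) p - HH a (m+1) p = (a p - a 0) * HH a m (p+1) := by
  linear_combination HH_last a m p - HH_first a m p

theorem HH_comp {k : Type*} [Field k] (a : ℕ → k[X]) (q : k[X]) (m p : ℕ) :
    (HH a m p).comp q = HH (fun i => (a i).comp q) m p := by
  unfold HH
  simp only [← Polynomial.coe_compRingHom_apply, map_sum, map_prod]

theorem HH_zero {R : Type*} [CommRing R] (a : ℕ → R) (p : ℕ) : HH a 0 p = 1 := by
  classical
  unfold HH
  have h : ∀ f : Fin 0 → Fin p, Monotone f := fun f i => i.elim0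
  rw [Finset.filter_true_of_mem (fun f _ => h f)]
  simp

theorem Ufrak_eq {k : Type*} [Field k] (u : k[X]) (lam : k) (n m p : ℕ) (j : ℤ)
    (hm : ((n : ℤ) - j).toNat = m) (hp : (j + 2).toNat = p) :
    Ufrak u lam n j = (-1) ^ m * HH (fun i => u.comp (X + C ((i : k) * lam))) m p := by
  subst hm hp
  rfl

/-- coefficients of V -/
noncomputable def VV {k : Type*} [Field k] (u : k[X]) (lam : k) (n j : ℕ) : k[X] :=
  (-1) ^ (n - j) * HH (fun i => u.comp (X + C (((i : k) + 1) * lam))) (n - j) (j + 1)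

theorem Vfrak_eq {k : Type*} [Field k] (u : k[X]) (lam : k) (n : ℕ) :
    Vfrak u lam n = ∑ j ∈ Finset.range (n+1), Finsupp.single j (VV u lam n j) := by
  rw [Finset.sum_range_succ, add_comm]
  unfold Vfrak
  congr 1
  · simp [VV, HH_zero]
  · refine Finset.sum_congr rfl fun j hj => ?_
    rw [Finset.mem_range] at hj
    rw [Ufrak_eq u lam (n-1) (n-j) (j+1) _ (by omega) (by omega)]
    unfold VV
    rw [mul_comp, HH_comp]
    congr 2
    · simp
    · congr 1
      funext i
      rw [comp_assoc]
      congr 1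
      simp only [add_comp, X_comp, C_comp, add_mul, C_add, one_mul]
      ring

theorem VV_key {k : Type*} [Field k] (u : k[X]) (lam : k) (n j : ℕ) (hj : j < n) :
    Tdiff lam (VV u lam n j) +
      VV u lam n (j+1) * (Tdiff (((j : k) + 1) * lam) u).comp (X + C lam) = 0 := by
  obtain ⟨m, rfl⟩ : ∃ m, n = j + 1 + m := ⟨n - (j+1), by omega⟩
  have h1 : j + 1 + m - j = m + 1 := by omega
  have h2 : j + 1 + m - (j + 1) = m := by omega
  have key := HH_key (fun i : ℕ => u.comp (X + C (((i : k) + 1) * lam))) m (j+1)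
  have hs : (fun i : ℕ => (u.comp (X + C (((i : k) + 1) * lam))).comp (X + C lam)) =
      fun i : ℕ => u.comp (X + C ((((i + 1 : ℕ) : k) + 1) * lam)) := by
    funext i
    rw [comp_assoc]
    congr 1
    simp only [add_comp, X_comp, C_comp, add_mul, C_add, one_mul, Nat.cast_add, Nat.cast_one]
    ring
  have ht : (Tdiff (((j : k) + 1) * lam) u).comp (X + C lam) =
      u.comp (X + C ((((j + 1 : ℕ) : k) + 1) * lam)) -
        u.comp (X + C ((((0 : ℕ) : k) + 1) * lam)) := by
    unfold Tdiff
    rw [sub_comp, comp_assoc]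
    congr 2
    · simp only [add_comp, X_comp, C_comp, add_mul, C_add, one_mul, Nat.cast_add, Nat.cast_one]
      ring
    · simp
  have hc : ((-1 : k[X]) ^ (m+1)).comp (X + C lam) = (-1) ^ (m+1) := by simp
  rw [ht]
  unfold Tdiff VV
  rw [h1, h2, mul_comp, HH_comp, hs, hc]
  linear_combination (-1 : k[X]) ^ (m+1) * key

theorem VV_top {k : Type*} [Field k] (u : k[X]) (lam : k) (n : ℕ) :
    Tdiff lam (VV u lam n n) = 0 := by
  simp [VV, HH_zero, Tdiff]

/-- Lemma 2.2.5 of Guccione–Guccione: `𝔙_n` lies in the kernel of the boundary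
map `δ₁₁` of `W_{**}(E)` (on the summand `⊕_{j≥0} k[t]·x^j y^j e₁e₂`, modelled
as `ℕ →₀ k[t]`). -/
theorem stmt12 {k : Type*} [Field k] [CharZero k] (lam : k) (hlam : lam ≠ 0)
    (u : k[X])
    (D : (ℕ →₀ k[X]) →ₗ[k] (ℕ →₀ k[X]))
    (hD0 : ∀ Q : k[X], D (Finsupp.single 0 Q) = -Finsupp.single 0 (Tdiff lam Q))
    (hD : ∀ (j : ℕ) (Q : k[X]),
      D (Finsupp.single (j + 1) Q) =
        -Finsupp.single (j + 1) (Tdiff lam Q) -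
          Finsupp.single j (Q * (Tdiff (((j : k) + 1) * lam) u).comp (X + C lam))) :
    ∀ n : ℕ, D (Vfrak u lam n) = 0 := by
  intro n
  rw [Vfrak_eq, map_sum, Finset.sum_range_succ']
  simp only [hD, hD0]
  rw [Finset.sum_sub_distrib, sub_add_eq_add_sub,
    ← Finset.sum_range_succ' (fun j => -Finsupp.single j (Tdiff lam (VV u lam n j))),
    Finset.sum_range_succ, VV_top, Finsupp.single_zero, neg_zero, add_zero,
    ← Finset.sum_sub_distrib]
  refine Finset.sum_eq_zero fun j hj => ?_
  rw [← Finsupp.single_neg, ← Finsupp.single_sub]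
  rw [Finsupp.single_eq_zero]
  linear_combination -VV_key u lam n j (Finset.mem_range.mp hj)
end
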